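/- arXiv:2304.00529 — 2 statements merged into one kernel-verified Lean document; each statement's English description precedes it below -/
import Mathlib

section
/- Let f : 𝕋 × ℝ₊ → ℝ be continuously differentiable in y with both sides finite, and let λ < −1/2. If f(x,0) = 0 for every x ∈ 𝕋, then ‖(1+y)^λ f‖_{L²(𝕋×ℝ₊)} ≤ (−2/(2λ+1)) ‖(1+y)^{λ+1} ∂_y f‖_{L²(𝕋×ℝ₊)}. -/
open MeasureTheory Real Set Filter

noncomputable section

/-- The domain Ω = 𝕋 × ℝ₊, realized as (0,1) × (0,∞) with x understood with period 1. -/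
def OmegaSet : Set (ℝ × ℝ) := Ioo (0:ℝ) 1 ×ˢ Ioi (0:ℝ)

/-- Partial derivative in x. -/
def pdx (f : ℝ × ℝ → ℝ) : ℝ × ℝ → ℝ := fun p => deriv (fun x => f (x, p.2)) p.1

/-- Partial derivative in y. -/
def pdy (f : ℝ × ℝ → ℝ) : ℝ × ℝ → ℝ := fun p => deriv (fun y => f (p.1, y)) p.2

/-- Mixed derivative `D^α = ∂_x^{α₁} ∂_y^{α₂}`. -/
def Dxy (a b : ℕ) (f : ℝ × ℝ → ℝ) : ℝ × ℝ → ℝ := pdx^[a] (pdy^[b] f)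

/-- Weighted L² norm `‖(1+y)^λ f‖_{L²(Ω)}`. -/
def wnorm (lam : ℝ) (f : ℝ × ℝ → ℝ) : ℝ :=
  Real.sqrt (∫ p in OmegaSet, ((1 + p.2) ^ lam * f p) ^ 2)

/-- Sup (L∞) norm over Ω. -/
def OmSup (f : ℝ × ℝ → ℝ) : ℝ := ⨆ p ∈ OmegaSet, |f p|

/-- L²(𝕋) norm. -/
def tnorm (f : ℝ → ℝ) : ℝ := Real.sqrt (∫ x in Ioo (0:ℝ) 1, (f x) ^ 2)

/-- L∞(𝕋) norm. -/
def tsup (f : ℝ → ℝ) : ℝ := ⨆ x ∈ Ioo (0:ℝ) 1, |f x|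

/-- H^m(𝕋) norm. -/
def Hper (m : ℕ) (f : ℝ → ℝ) : ℝ :=
  Real.sqrt (∑ j ∈ Finset.range (m+1), ∫ x in Ioo (0:ℝ) 1, (iteratedDeriv j f x) ^ 2)

/-- Multi-indices α = (α₁, α₂) with |α| ≤ s. -/
def idxFull (s : ℕ) : Finset (ℕ × ℕ) :=
  (Finset.range (s+1) ×ˢ Finset.range (s+1)).filter (fun a => a.1 + a.2 ≤ s)

/-- Multi-indices with |α| ≤ s and α₁ ≤ s − 1. -/
def idxLow (s : ℕ) : Finset (ℕ × ℕ) :=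
  (idxFull s).filter (fun a => a.1 ≤ s - 1)

/-- Squared weighted Sobolev norm `‖w‖²_{H^{s,γ}}`. -/
def HnormSq (s : ℕ) (γ : ℝ) (w : ℝ × ℝ → ℝ) : ℝ :=
  ∑ a ∈ idxFull s, (wnorm (γ + a.2) (Dxy a.1 a.2 w)) ^ 2

/-- `g_k = ∂_x^k w − (∂_y w / w) ∂_x^k (u − U)`. -/
def gfun (w u : ℝ × ℝ → ℝ) (U : ℝ → ℝ) (k : ℕ) : ℝ × ℝ → ℝ :=
  fun p => Dxy k 0 w p - (pdy w p / w p) * Dxy k 0 (fun q => u q - U q.1) p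

/-- Squared norm `‖w‖²_{H^{s,γ}_g}`. -/
def GnormSq (s : ℕ) (γ : ℝ) (w u : ℝ × ℝ → ℝ) (U : ℝ → ℝ) : ℝ :=
  (wnorm γ (gfun w u U s)) ^ 2
    + ∑ a ∈ idxLow s, (wnorm (γ + a.2) (Dxy a.1 a.2 w)) ^ 2

/-- Membership `w ∈ H^{s,γ}_{σ,δ}`: finite `H^{s,γ}` norm, the pointwise lower bound
`(1+y)^σ w ≥ δ`, and the pointwise bound `Σ_{|α|≤2} |(1+y)^{σ+α₂} D^α w|² ≤ δ^{-2}`. -/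
def MemH (s : ℕ) (γ σ δ : ℝ) (w : ℝ × ℝ → ℝ) : Prop :=
  (∀ a ∈ idxFull s,
      IntegrableOn (fun p => ((1 + p.2) ^ (γ + a.2) * Dxy a.1 a.2 w p) ^ 2) OmegaSet) ∧
  (∀ p ∈ OmegaSet, δ ≤ (1 + p.2) ^ σ * w p) ∧
  (∀ p ∈ OmegaSet,
      ∑ a ∈ idxFull 2, ((1 + p.2) ^ (σ + a.2) * Dxy a.1 a.2 w p) ^ 2 ≤ (δ ^ 2)⁻¹)

/-- `u(x,y) = U(x) − ∫_y^∞ w(x,ỹ) dỹ`. -/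
def uOf (U : ℝ → ℝ) (w : ℝ × ℝ → ℝ) : ℝ × ℝ → ℝ :=
  fun p => U p.1 - ∫ t in Ioi p.2, w (p.1, t)

/-- `v(x,y) = − ∫_0^y ∂_x u(x,ỹ) dỹ`. -/
def vOf (u : ℝ × ℝ → ℝ) : ℝ × ℝ → ℝ :=
  fun p => -∫ t in (0:ℝ)..p.2, pdx u (p.1, t)

/-- Classical solution of the ε-regularized Prandtl–Hartmann system on (0,T) × 𝕋 × ℝ₊:
the momentum equation, the divergence-free condition, no-slip boundary conditions,
the far-field condition `u → U`, and the regularized Bernoulli law, together with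
smoothness and x-periodicity of all data. -/
def IsRegSol (ε T : ℝ) (u v : ℝ → ℝ × ℝ → ℝ) (U P : ℝ → ℝ → ℝ) : Prop :=
  ContDiff ℝ (⊤ : ℕ∞) (fun q : ℝ × (ℝ × ℝ) => u q.1 q.2) ∧
  ContDiff ℝ (⊤ : ℕ∞) (fun q : ℝ × (ℝ × ℝ) => v q.1 q.2) ∧
  ContDiff ℝ (⊤ : ℕ∞) (fun q : ℝ × ℝ => U q.1 q.2) ∧
  ContDiff ℝ (⊤ : ℕ∞) (fun q : ℝ × ℝ => P q.1 q.2) ∧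
  (∀ t x y, u t (x + 1, y) = u t (x, y) ∧ v t (x + 1, y) = v t (x, y)) ∧
  (∀ t x, U t (x + 1) = U t x ∧ P t (x + 1) = P t x) ∧
  (∀ t ∈ Ioo (0:ℝ) T, ∀ x : ℝ, ∀ y ∈ Ici (0:ℝ),
      deriv (fun r => u r (x, y)) t + u t (x, y) * pdx (u t) (x, y)
          + v t (x, y) * pdy (u t) (x, y)
        = (U t x - u t (x, y)) + ε ^ 2 * Dxy 2 0 (u t) (x, y)
          + Dxy 0 2 (u t) (x, y) - deriv (P t) x) ∧
  (∀ t ∈ Ioo (0:ℝ) T, ∀ x : ℝ, ∀ y ∈ Ici (0:ℝ),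
      pdx (u t) (x, y) + pdy (v t) (x, y) = 0) ∧
  (∀ t ∈ Ioo (0:ℝ) T, ∀ x : ℝ, u t (x, 0) = 0 ∧ v t (x, 0) = 0) ∧
  (∀ t ∈ Ioo (0:ℝ) T, ∀ x : ℝ,
      Tendsto (fun y => u t (x, y)) atTop (nhds (U t x))) ∧
  (∀ t ∈ Ioo (0:ℝ) T, ∀ x : ℝ,
      deriv (fun r => U r x) t + U t x * deriv (U t) x
        - ε ^ 2 * deriv (deriv (U t)) x + deriv (P t) x = 0)

theorem hardy_slice (g : ℝ → ℝ) (lam : ℝ) (hlam : lam < -(1/2)) (hg : ContDiff ℝ 1 g)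
    (h0 : g 0 = 0) :
    0 ≤ ∫ y in Ioi (0:ℝ), ((2 / (-(2*lam+1))) * ((1 + y) ^ (lam + 1) * deriv g y) ^ 2
      - ((-(2*lam+1)) / 2) * ((1 + y) ^ lam * g y) ^ 2) := by
  set c : ℝ := -(2*lam+1) with hc
  have hcpos : 0 < c := by rw [hc]; linarith
  set h : ℝ → ℝ := fun y => (2 / c) * ((1 + y) ^ (lam + 1) * deriv g y) ^ 2
      - (c / 2) * ((1 + y) ^ lam * g y) ^ 2 with hh
  by_cases hi : IntegrableOn h (Ioi 0)
  swap
  · exact (integral_undef hi).ge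
  have hlim := intervalIntegral_tendsto_integral_Ioi (0:ℝ) hi tendsto_id
  refine ge_of_tendsto hlim ?_
  filter_upwards [eventually_ge_atTop (0:ℝ)] with R hR
  simp only [id]
  have hgd : ∀ y, HasDerivAt g (deriv g y) y := fun y =>
    (hg.differentiable (by norm_num) y).hasDerivAt
  have hgc : Continuous g := hg.continuous
  have hg'c : Continuous (deriv g) := hg.continuous_deriv (by norm_num)
  have hpow : ∀ a : ℝ, ContinuousOn (fun y : ℝ => (1 + y) ^ a) (uIcc 0 R) := by
    intro a
    rw [uIcc_of_le hR]
    refine ContinuousOn.rpow_const (by fun_prop) ?_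
    intro y hy
    left
    have := hy.1
    linarith
  have hhc : ContinuousOn h (uIcc 0 R) := by
    have h1 := hpow (lam+1)
    have h2 := hpow lam
    exact (continuousOn_const.mul ((h1.mul hg'c.continuousOn).pow 2)).sub
      (continuousOn_const.mul ((h2.mul hgc.continuousOn).pow 2))
  set G' : ℝ → ℝ := fun y => ((2*lam+1) * (1 + y) ^ (2*lam)) * (g y)^2
      + (1+y)^(2*lam+1) * (2 * g y * deriv g y) with hG'
  have hG'c : ContinuousOn G' (uIcc 0 R) := by
    have h1 := hpow (2*lam+1)
    have h2 := hpow (2*lam)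
    have h3 := hgc.continuousOn (s := uIcc 0 R)
    have h4 := hg'c.continuousOn (s := uIcc 0 R)
    exact ((continuousOn_const.mul h2).mul (h3.pow 2)).add
      (h1.mul ((continuousOn_const.mul h3).mul h4))
  have hFTC : ∫ y in (0:ℝ)..R, G' y = (1+R)^(2*lam+1) * (g R)^2 - (1+0)^(2*lam+1) * (g 0)^2 := by
    refine intervalIntegral.integral_eq_sub_of_hasDerivAt
      (f := fun y => (1+y)^(2*lam+1) * (g y)^2) ?_ hG'c.intervalIntegrable
    intro y hy
    rw [uIcc_of_le hR] at hy
    have hy0 : (0:ℝ) < 1 + y := by linarith [hy.1]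
    have h1 : HasDerivAt (fun y : ℝ => 1 + y) 1 y := (hasDerivAt_id y).const_add 1
    have h2 := h1.rpow_const (p := 2*lam+1) (Or.inl hy0.ne')
    have h3 := (hgd y).pow 2
    have h4 := h2.mul h3
    refine HasDerivAt.congr_deriv h4 ?_
    simp only [hG', Pi.pow_apply]
    rw [show 2*lam+1-1 = 2*lam by ring]
    push_cast
    ring
  have hmono : ∫ y in (0:ℝ)..R, G' y ≤ ∫ y in (0:ℝ)..R, h y := by
    refine intervalIntegral.integral_mono_on hR hG'c.intervalIntegrable hhc.intervalIntegrable ?_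
    intro y hy
    have hy0 : (0:ℝ) < 1 + y := by linarith [hy.1]
    have e1 : (1+y)^(2*lam) = (1+y)^lam * (1+y)^lam := by
      rw [← Real.rpow_add hy0]; ring_nf
    have e2 : (1+y)^(2*lam+1) = (1+y)^lam * (1+y)^(lam+1) := by
      rw [← Real.rpow_add hy0]; ring_nf
    have hl : 2*lam+1 = -c := by rw [hc]; ring
    simp only [hG', hh]
    rw [e2, e1, hl]
    set A := (1+y)^lam
    set B := (1+y)^(lam+1)
    have key : 0 ≤ (2/c) * (B * deriv g y - c/2 * (A * g y))^2 := by positivity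
    have : (2/c) * (B * deriv g y - c/2 * (A * g y))^2
      = (2 / c) * (B * deriv g y) ^ 2 - (c / 2) * (A * g y) ^ 2
        - (-c * (A * A) * g y ^ 2 + A * B * (2 * g y * deriv g y)) := by
      field_simp
      ring
    linarith
  have hpos : 0 ≤ (1+R)^(2*lam+1) * (g R)^2 := by positivity
  rw [hFTC, h0] at hmono
  simp only [ne_eq, OfNat.ofNat_ne_zero, not_false_eq_true, zero_pow, mul_zero, sub_zero] at hmono
  linarith

/-- Hardy-type inequality, case λ < −1/2. -/
theorem stmt2 (f : ℝ × ℝ → ℝ) (lam : ℝ) (hlam : lam < -(1/2))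
    (hreg : ∀ x : ℝ, ContDiff ℝ 1 (fun y => f (x, y)))
    (hint : IntegrableOn (fun p => ((1 + p.2) ^ lam * f p) ^ 2) OmegaSet)
    (hint' : IntegrableOn (fun p => ((1 + p.2) ^ (lam + 1) * pdy f p) ^ 2) OmegaSet)
    (hbd : ∀ x : ℝ, f (x, 0) = 0) :
    wnorm lam f ≤ (-2 / (2 * lam + 1)) * wnorm (lam + 1) (pdy f) := by
  have hcpos : 0 < -(2*lam+1) := by linarith
  have hI := (hint'.const_mul (2 / (-(2*lam+1)))).sub (hint.const_mul ((-(2*lam+1)) / 2))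
  have hnn : 0 ≤ ∫ p in OmegaSet, ((2 / (-(2*lam+1))) * ((1 + p.2) ^ (lam + 1) * pdy f p) ^ 2
      - ((-(2*lam+1)) / 2) * ((1 + p.2) ^ lam * f p) ^ 2) := by
    unfold OmegaSet at hI ⊢
    rw [Measure.volume_eq_prod] at hI ⊢
    refine le_of_le_of_eq ?_ (setIntegral_prod _ hI).symm
    refine integral_nonneg fun x => ?_
    exact hardy_slice (fun y => f (x, y)) lam hlam (hreg x) (hbd x)
  rw [integral_sub (hint'.const_mul _) (hint.const_mul _), integral_const_mul,
    integral_const_mul] at hnn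
  unfold wnorm
  set a := ∫ p in OmegaSet, ((1 + p.2) ^ lam * f p) ^ 2
  set b := ∫ p in OmegaSet, ((1 + p.2) ^ (lam + 1) * pdy f p) ^ 2
  have hk : -2 / (2*lam+1) = 2 / (-(2*lam+1)) := by rw [div_neg, neg_div]
  rw [hk]
  set c := -(2*lam+1)
  rw [← Real.sqrt_sq (show (0:ℝ) ≤ 2 / c by positivity), ← Real.sqrt_mul (by positivity)]
  apply Real.sqrt_le_sqrt
  have h2 : (2/c)^2 * b - a = (2/c) * (2/c*b - c/2*a) := by field_simp
  have h3 : 0 ≤ (2/c) * (2/c*b - c/2*a) := by positivity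
  linarith
end
end

section
/- Let (u,v) be a classical solution (of class C³ up to the boundary) of the regularized Prandtl–Hartmann system with parameter ε > 0 on (0,T) × 𝕋 × ℝ₊, and let w = ∂_y u be its vorticity. Then on the boundary y = 0 one has, for all t ∈ (0,T) and x ∈ 𝕋: ∂_y³ w(t,x,0) = (∂_t − ε² ∂_x²)(∂_x P − U)(t,x) + (∂_x P − U)(t,x) + (w ∂_x w)(t,x,0). -/
open MeasureTheory Real Set Filter

noncomputable section

/-- Directional derivative. -/
def Dd (e : ℝ × (ℝ × ℝ)) (f : ℝ × (ℝ × ℝ) → ℝ) : ℝ × (ℝ × ℝ) → ℝ := fun q => fderiv ℝ f q e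

abbrev eT : ℝ × (ℝ × ℝ) := (1, (0, 0))
abbrev eX : ℝ × (ℝ × ℝ) := (0, (1, 0))
abbrev eY : ℝ × (ℝ × ℝ) := (0, (0, 1))

abbrev Smo (f : ℝ × (ℝ × ℝ) → ℝ) : Prop := ContDiff ℝ (⊤ : ℕ∞) f

lemma Dd_smooth {f : ℝ × (ℝ × ℝ) → ℝ} (hf : Smo f) (e : ℝ × (ℝ × ℝ)) : Smo (Dd e f) := by
  have h : ContDiff ℝ (⊤ : ℕ∞) (fderiv ℝ f) := hf.fderiv_right (by simp)
  exact h.clm_apply contDiff_const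

lemma Smo_diff {f : ℝ × (ℝ × ℝ) → ℝ} (hf : Smo f) : Differentiable ℝ f :=
  hf.differentiable (by simp)

lemma Dd_comm {f : ℝ × (ℝ × ℝ) → ℝ} (hf : Smo f) (a b : ℝ × (ℝ × ℝ)) :
    Dd a (Dd b f) = Dd b (Dd a f) := by
  have h : ContDiff ℝ (⊤ : ℕ∞) (fderiv ℝ f) := hf.fderiv_right (by simp)
  have hd : Differentiable ℝ (fderiv ℝ f) := h.differentiable (by simp)
  funext q
  have key : ∀ a b : ℝ × (ℝ × ℝ), Dd a (Dd b f) q = fderiv ℝ (fderiv ℝ f) q a b := by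
    intro a b
    have := (hd q).hasFDerivAt.clm_apply (hasFDerivAt_const b q)
    unfold Dd
    rw [this.fderiv]
    simp
  rw [key, key]
  have hs : IsSymmSndFDerivAt ℝ f q := (hf.contDiffAt).isSymmSndFDerivAt (by rw [minSmoothness_of_isRCLikeNormedField]; exact WithTop.coe_le_coe.2 (OrderTop.le_top (2 : ℕ∞)))
  exact hs a b

lemma slT {f : ℝ × (ℝ × ℝ) → ℝ} (hf : Smo f) (t x y : ℝ) :
    HasDerivAt (fun r => f (r, (x, y))) (Dd eT f (t, (x, y))) t := by
  have h1 : HasDerivAt (fun r : ℝ => (r, (x, y))) eT t :=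
    (hasDerivAt_id t).prodMk (hasDerivAt_const t (x, y))
  exact (Smo_diff hf (t, (x, y))).hasFDerivAt.comp_hasDerivAt t h1

lemma slX {f : ℝ × (ℝ × ℝ) → ℝ} (hf : Smo f) (t x y : ℝ) :
    HasDerivAt (fun r => f (t, (r, y))) (Dd eX f (t, (x, y))) x := by
  have h1 : HasDerivAt (fun r : ℝ => (t, (r, y))) eX x :=
    (hasDerivAt_const x t).prodMk ((hasDerivAt_id x).prodMk (hasDerivAt_const x y))
  exact (Smo_diff hf (t, (x, y))).hasFDerivAt.comp_hasDerivAt x h1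

lemma slY {f : ℝ × (ℝ × ℝ) → ℝ} (hf : Smo f) (t x y : ℝ) :
    HasDerivAt (fun r => f (t, (x, r))) (Dd eY f (t, (x, y))) y := by
  have h1 : HasDerivAt (fun r : ℝ => (t, (x, r))) eY y :=
    (hasDerivAt_const y t).prodMk ((hasDerivAt_const y x).prodMk (hasDerivAt_id y))
  exact (Smo_diff hf (t, (x, y))).hasFDerivAt.comp_hasDerivAt y h1

lemma pdx_lift {f : ℝ × (ℝ × ℝ) → ℝ} (hf : Smo f) (t : ℝ) :
    pdx (fun p => f (t, p)) = fun p => Dd eX f (t, p) := by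
  funext p; exact (slX hf t p.1 p.2).deriv

lemma pdy_lift {f : ℝ × (ℝ × ℝ) → ℝ} (hf : Smo f) (t : ℝ) :
    pdy (fun p => f (t, p)) = fun p => Dd eY f (t, p) := by
  funext p; exact (slY hf t p.1 p.2).deriv

lemma zero_der {e : ℝ → ℝ} {e' y : ℝ} (h : ∀ y ∈ Ici (0:ℝ), e y = 0) (hy : y ∈ Ici (0:ℝ))
    (he : HasDerivAt e e' y) : e' = 0 := by
  have h1 : HasDerivWithinAt e e' (Ici 0) y := he.hasDerivWithinAt
  have h2 : HasDerivWithinAt e 0 (Ici 0) y :=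
    (hasDerivWithinAt_const y (Ici (0:ℝ)) (0:ℝ)).congr h (h y hy)
  exact (uniqueDiffOn_Ici (0:ℝ) y hy).eq_deriv _ h1 h2

/-- on the boundary `y = 0`,
`∂_y³ w = (∂_t − ε²∂_x²)(∂_x P − U) + (∂_x P − U) + w ∂_x w`. -/
theorem stmt12 (ε T : ℝ) (hε : 0 < ε) (u v : ℝ → ℝ × ℝ → ℝ) (U P : ℝ → ℝ → ℝ)
    (hsol : IsRegSol ε T u v U P) :
    ∀ t ∈ Ioo (0:ℝ) T, ∀ x : ℝ,
      Dxy 0 3 (pdy (u t)) (x, 0)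
        = (deriv (fun r => deriv (P r) x - U r x) t
            - ε ^ 2 * deriv (deriv (fun x' => deriv (P t) x' - U t x')) x)
          + (deriv (P t) x - U t x)
          + pdy (u t) (x, 0) * pdx (pdy (u t)) (x, 0) := by
  obtain ⟨hu, hv, -, -, -, -, hmom, hdiv, hbc, -, -⟩ := hsol
  obtain ⟨F, hF⟩ : ∃ F : ℝ × (ℝ × ℝ) → ℝ, F = fun q => u q.1 q.2 := ⟨_, rfl⟩
  obtain ⟨V, hV⟩ : ∃ V : ℝ × (ℝ × ℝ) → ℝ, V = fun q => v q.1 q.2 := ⟨_, rfl⟩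
  have sF : Smo F := hF ▸ hu
  have sV : Smo V := hV ▸ hv
  have uF : u = fun t p => F (t, p) := by subst hF; rfl
  have vV : v = fun t p => V (t, p) := by subst hV; rfl
  clear hF hV hu hv
  subst uF vV
  have sT := Dd_smooth sF eT
  have sX := Dd_smooth sF eX
  have sY := Dd_smooth sF eY
  have sXX := Dd_smooth sX eX
  have sYY := Dd_smooth sY eY
  have sYYY := Dd_smooth sYY eY
  have sVY := Dd_smooth sV eY
  simp only [Dxy, Function.iterate_succ, Function.iterate_zero, Function.comp, id,
    pdx_lift sF, pdx_lift sX, pdy_lift sF, pdy_lift sY, pdy_lift sYY, pdy_lift sYYY,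
    pdy_lift sV, pdx_lift sY, (slT sF _ _ _).deriv] at hmom hdiv ⊢
  beta_reduce at hbc
  have bX : ∀ t ∈ Ioo (0:ℝ) T, ∀ x, Dd eX F (t, (x, 0)) = 0 := by
    intro t ht x
    have h0 : (fun r => F (t, (r, 0))) = fun _ => (0:ℝ) := funext fun r => (hbc t ht r).1
    rw [← (slX sF t x 0).deriv, h0]; simp
  have bXX : ∀ t ∈ Ioo (0:ℝ) T, ∀ x, Dd eX (Dd eX F) (t, (x, 0)) = 0 := by
    intro t ht x
    have h0 : (fun r => Dd eX F (t, (r, 0))) = fun _ => (0:ℝ) := funext fun r => bX t ht r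
    rw [← (slX sX t x 0).deriv, h0]; simp
  have bT : ∀ t ∈ Ioo (0:ℝ) T, ∀ x, Dd eT F (t, (x, 0)) = 0 := by
    intro t ht x
    have h0 : (fun r => F (r, (x, 0))) =ᶠ[nhds t] fun _ => (0:ℝ) := by
      filter_upwards [isOpen_Ioo.mem_nhds ht] with r hr using (hbc r hr x).1
    rw [← (slT sF t x 0).deriv, h0.deriv_eq]; simp
  have bG : ∀ t ∈ Ioo (0:ℝ) T, ∀ x, deriv (P t) x - U t x = Dd eY (Dd eY F) (t, (x, 0)) := by
    intro t ht x
    have h := hmom t ht x 0 (by simp)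
    rw [bT t ht x, bXX t ht x, (hbc t ht x).1, (hbc t ht x).2] at h
    linarith
  intro t ht x
  have gT : deriv (fun r => deriv (P r) x - U r x) t = Dd eT (Dd eY (Dd eY F)) (t, (x, 0)) := by
    have h0 : (fun r => deriv (P r) x - U r x) =ᶠ[nhds t]
        fun r => Dd eY (Dd eY F) (r, (x, 0)) := by
      filter_upwards [isOpen_Ioo.mem_nhds ht] with r hr using bG r hr x
    rw [h0.deriv_eq, (slT sYY t x 0).deriv]
  have gXX : deriv (deriv (fun x' => deriv (P t) x' - U t x')) x
      = Dd eX (Dd eX (Dd eY (Dd eY F))) (t, (x, 0)) := by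
    have h0 : (fun r => deriv (P t) r - U t r) = fun r => Dd eY (Dd eY F) (t, (r, 0)) :=
      funext fun r => bG t ht r
    have h1 : deriv (fun r => Dd eY (Dd eY F) (t, (r, 0)))
        = fun r => Dd eX (Dd eY (Dd eY F)) (t, (r, 0)) :=
      funext fun r => (slX sYY t r 0).deriv
    rw [h0, h1, (slX (Dd_smooth sYY eX) t x 0).deriv]
  rw [gT, gXX, bG t ht x]
  -- first and second y-derivatives of the momentum equation
  have E0 : ∀ y ∈ Ici (0:ℝ), Dd eT F (t, (x, y)) + F (t, (x, y)) * Dd eX F (t, (x, y))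
      + V (t, (x, y)) * Dd eY F (t, (x, y)) + F (t, (x, y))
      - ε ^ 2 * Dd eX (Dd eX F) (t, (x, y)) - Dd eY (Dd eY F) (t, (x, y))
      + (deriv (P t) x - U t x) = 0 := by
    intro y hy
    linarith [hmom t ht x y hy]
  have E1 := fun y hy => zero_der E0 hy
    ((((((((slY sT t x y).add ((slY sF t x y).mul (slY sX t x y))).add
      ((slY sV t x y).mul (slY sY t x y))).add (slY sF t x y)).sub
      ((slY sXX t x y).const_mul (ε ^ 2))).sub (slY sYY t x y))).add_const _)
  have E2 := zero_der E1 (y := 0) (by simp)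
    ((((((slY (Dd_smooth sT eY) t x 0).add
      (((slY sY t x 0).mul (slY sX t x 0)).add
        ((slY sF t x 0).mul (slY (Dd_smooth sX eY) t x 0)))).add
      (((slY sVY t x 0).mul (slY sY t x 0)).add
        ((slY sV t x 0).mul (slY sYY t x 0)))).add (slY sY t x 0)).sub
      ((slY (Dd_smooth sXX eY) t x 0).const_mul (ε ^ 2))).sub (slY sYYY t x 0))
  have E3 := zero_der (hdiv t ht x) (y := 0) (by simp)
    ((slY sX t x 0).add (slY sVY t x 0))
  have E4 := hdiv t ht x 0 (by simp)
  have c1 : Dd eY (Dd eY (Dd eT F)) = Dd eT (Dd eY (Dd eY F)) := by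
    rw [Dd_comm sF eY eT, Dd_comm sY eY eT]
  have c2 : Dd eY (Dd eX F) = Dd eX (Dd eY F) := Dd_comm sF eY eX
  have c3 : Dd eY (Dd eY (Dd eX (Dd eX F))) = Dd eX (Dd eX (Dd eY (Dd eY F))) := by
    rw [Dd_comm sX eY eX, c2, Dd_comm (Dd_smooth sY eX) eY eX, Dd_comm sY eY eX]
  rw [bX t ht x] at E4
  rw [c2] at E3
  have hVY : Dd eY V (t, (x, 0)) = 0 := by linarith
  have hVYY : Dd eY (Dd eY V) (t, (x, 0)) = - Dd eX (Dd eY F) (t, (x, 0)) := by linarith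
  rw [c1, c2, c3, hVY, hVYY, bX t ht x, (hbc t ht x).1, (hbc t ht x).2] at E2
  linarith
end
end
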